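/- Let A, B ∈ ℝ^{m×m} be symmetric positive semidefinite matrices and let σ > 0. Let S := (A + σ² I)^{1/2} denote the positive definite square root of A + σ² I. Then S^{−1} (S^{−1} B S^{−1} + I)^{−1} S^{−1} = (A + B + σ² I)^{−1}. Consequently, for a kernel with feature map into ℝ^m, conditioning the Gaussian process posterior first on a set of inputs with feature second-moment matrix A and then on a set with feature second-moment matrix B (both with noise variance σ²) yields the same posterior kernel as conditioning on their disjoint union at once: k_{→post(X₁ ∪ X₂, σ²)} = k_{→post(X₁, σ²) →post(X₂, σ²)}. -/

import Mathlib

open Matrix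

/-- Composition of GP posterior transformations: if `S` is the positive definite square root
of `A + σ²I`, then `S⁻¹ (S⁻¹ B S⁻¹ + I)⁻¹ S⁻¹ = (A + B + σ²I)⁻¹`, i.e. conditioning first
on data with feature second-moment matrix `A` and then on data with feature second-moment
matrix `B` equals conditioning on their disjoint union at once. -/
theorem stmt_10 (m : ℕ) (A B : Matrix (Fin m) (Fin m) ℝ)
    (hA : A.PosSemidef) (hB : B.PosSemidef) (σ : ℝ) (hσ : 0 < σ)
    (S : Matrix (Fin m) (Fin m) ℝ) (hSpd : S.PosDef)
    (hSsq : S * S = A + σ ^ 2 • (1 : Matrix (Fin m) (Fin m) ℝ)) :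
    S⁻¹ * (S⁻¹ * B * S⁻¹ + 1)⁻¹ * S⁻¹
      = (A + B + σ ^ 2 • (1 : Matrix (Fin m) (Fin m) ℝ))⁻¹ := by
  have hS : IsUnit S.det := (isUnit_iff_isUnit_det S).mp hSpd.isUnit
  have factor : S * (S⁻¹ * B * S⁻¹ + 1) * S
      = A + B + σ ^ 2 • (1 : Matrix (Fin m) (Fin m) ℝ) := by
    calc S * (S⁻¹ * B * S⁻¹ + 1) * S
        = (S * S⁻¹) * B * (S⁻¹ * S) + S * S := by noncomm_ring
      _ = A + B + σ ^ 2 • (1 : Matrix (Fin m) (Fin m) ℝ) := by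
        rw [mul_nonsing_inv S hS, nonsing_inv_mul S hS, hSsq, one_mul, mul_one]
        abel
  rw [← factor, Matrix.mul_inv_rev, Matrix.mul_inv_rev, Matrix.mul_assoc]
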